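/- arXiv:1902.00807 — 5 statements merged into one kernel-verified Lean document; each statement's English description precedes it below -/
import Mathlib

section
/- Let y ∈ W^K_min, that is, y ∈ S_n with y^{-1}(1) < ⋯ < y^{-1}(k) and y^{-1}(k+1) < ⋯ < y^{-1}(n). Then the antiexcedance set of y (with fixed points of y lying in {1,…,k} declared white), namely {i ∈ [n] : y^{-1}(i) > i} ∪ {i ∈ {1,…,k} : y(i) = i}, equals {1,…,k}. -/
/-- `y` fixes every point outside `{1, …, n}`. -/
def fixesOutside (n : ℕ) (y : Equiv.Perm ℕ) : Prop :=
  ∀ i, i ∉ Finset.Icc 1 n → y i = i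

/-- `y ∈ W^K_min`: `y⁻¹(1) < ⋯ < y⁻¹(k)` and `y⁻¹(k+1) < ⋯ < y⁻¹(n)`. -/
def isWKmin (n k : ℕ) (y : Equiv.Perm ℕ) : Prop :=
  fixesOutside n y ∧
  (∀ i j, 1 ≤ i → i < j → j ≤ k → y.symm i < y.symm j) ∧
  (∀ i j, k + 1 ≤ i → i < j → j ≤ n → y.symm i < y.symm j)

/-- The inverse of a permutation fixing every point outside `{1, …, n}` maps `{1, …, n}` to itself. -/
theorem fixesOutside.symm_mem_Icc {n : ℕ} {y : Equiv.Perm ℕ} (h : fixesOutside n y) {i : ℕ}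
    (hi : i ∈ Finset.Icc 1 n) : y.symm i ∈ Finset.Icc 1 n := by
  by_contra hc
  have hfix := h _ hc
  rw [Equiv.apply_symm_apply] at hfix
  exact hc (hfix ▸ hi)

theorem isWKmin.le_symm_apply {n k : ℕ} {y : Equiv.Perm ℕ} (hy : isWKmin n k y) (hkn : k ≤ n)
    {i : ℕ} (hi : 1 ≤ i) (hik : i ≤ k) : i ≤ y.symm i := by
  induction i, hi using Nat.le_induction with
  | base => exact (Finset.mem_Icc.1 (hy.1.symm_mem_Icc (Finset.mem_Icc.2 ⟨le_rfl, by omega⟩))).1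
  | succ i hi ih =>
    have hlt := hy.2.1 i (i + 1) hi (by omega) hik
    have hle := ih (by omega)
    omega

theorem isWKmin.symm_apply_le {n k : ℕ} {y : Equiv.Perm ℕ} (hy : isWKmin n k y)
    {i : ℕ} (hki : k + 1 ≤ i) (hin : i ≤ n) : y.symm i ≤ i := by
  induction hin using Nat.decreasingInduction with
  | self => exact (Finset.mem_Icc.1 (hy.1.symm_mem_Icc (Finset.mem_Icc.2 ⟨by omega, le_rfl⟩))).2
  | of_succ i hi ih =>
    have hlt := hy.2.2 i (i + 1) hki (by omega) hi
    have hle := ih (by omega)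
    omega

/-- for `y ∈ W^K_min`, the antiexcedance set
`{i ∈ [n] : y⁻¹(i) > i} ∪ {i ∈ [k] : y(i) = i}` equals `{1,…,k}`. -/
theorem antiexcedances_of_WKmin (n k : ℕ) (hn : 2 ≤ n) (hk1 : 1 < k) (hkn : k < n)
    (y : Equiv.Perm ℕ) (hy : isWKmin n k y) :
    (Finset.Icc 1 n).filter (fun i => i < y.symm i ∨ (i ≤ k ∧ y i = i)) =
      Finset.Icc 1 k := by
  ext i
  simp only [Finset.mem_filter, Finset.mem_Icc]
  constructor
  · rintro ⟨⟨hi, hin⟩, hlt | ⟨hik, -⟩⟩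
    · refine ⟨hi, ?_⟩
      by_contra! hki
      exact (hy.symm_apply_le hki hin).not_gt hlt
    · exact ⟨hi, hik⟩
  · rintro ⟨hi, hik⟩
    refine ⟨⟨hi, by omega⟩, ?_⟩
    rcases (hy.le_symm_apply hkn.le hi hik).lt_or_eq with hlt | heq
    · exact Or.inl hlt
    · exact Or.inr ⟨hik, (y.eq_symm_apply.1 heq)⟩
end

section
/- Let λ be a Young diagram contained in the k×(n−k) rectangle, let b = (r,c) be a cell of λ, set ℓ := k+c−r, and let w_b be the partial columnar word of λ at b. Define J(b) := {1,…,k−r} ∪ {k−r+c+1,…,k+c} (the vertical-step labels of the r×c rectangle, which is the largest rectangle contained in λ with lower-right corner b). Then: (1) if ℓ < k, then J(b) = w_b({1,…,ℓ}) ∪ {ℓ+1,…,k}; (2) if ℓ = k, then J(b) = w_b({1,…,k}); (3) if ℓ > k, then J(b) = w_b({1,…,ℓ}) ∖ {k+1,…,ℓ}. -/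
/-- `lam` is a Young diagram contained in the `k × (n-k)` rectangle (rows `lam 1, …, lam k`,
weakly decreasing, each at most `n - k`). -/
def isYoung (n k : ℕ) (lam : ℕ → ℕ) : Prop :=
  lam 1 ≤ n - k ∧ ∀ r, 1 ≤ r → r < k → lam (r + 1) ≤ lam r

/-- the height of column `j` of the Young diagram `lam` (with `k` rows). -/
def colHeight (k : ℕ) (lam : ℕ → ℕ) (j : ℕ) : ℕ :=
  ((Finset.Icc 1 k).filter fun i => j ≤ lam i).card

/-- the partial columnar word `w_b` of `lam` at the cell `b = (r, c)`: the product of the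
simple transpositions `s_{k+c'−r'}` over the cells `(r', c')` read in columnar order
(columns left to right, top to bottom in each column) up to and including `(r, c)`;
the rightmost factor is applied first. -/
def colWord (k : ℕ) (lam : ℕ → ℕ) (r c : ℕ) : Equiv.Perm ℕ :=
  (((List.range' 1 (c - 1)).flatMap fun j =>
      (List.range' 1 (colHeight k lam j)).map fun i =>
        Equiv.swap (k + j - i) (k + j - i + 1)) ++
    ((List.range' 1 r).map fun i =>
        Equiv.swap (k + c - i) (k + c - i + 1))).prod

/-- The product `s_{t-1} s_{t-2} ⋯ s_{t-h}` is the cycle that sends `t - h` to `t` and lowers every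
element of `(t - h, t]` by one. -/
theorem prod_swap_descending_apply (t h x : ℕ) (hh : h ≤ t) :
    ((List.range' 1 h).map fun i => Equiv.swap (t - i) (t - i + 1)).prod x =
      if x = t - h then t else if t - h < x ∧ x ≤ t then x - 1 else x := by
  induction h generalizing x with
  | zero =>
    simp only [List.range'_zero, List.map_nil, List.prod_nil, Equiv.Perm.coe_one, id_eq]
    split_ifs <;> omega
  | succ h ih =>
    rw [List.range'_concat, List.map_append, List.prod_append, Equiv.Perm.mul_apply]
    simp only [List.map_cons, List.map_nil, List.prod_singleton]
    rw [ih _ (by omega), Equiv.swap_apply_def]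
    split_ifs <;> omega

theorem image_prod_swap_descending (t h a : ℕ) (hht : h < t) (hta : t ≤ a + 1 + h)
    (hat : a + 1 ≤ t) :
    (Finset.Icc 1 (a + 1)).image
        ⇑((List.range' 1 h).map fun i => Equiv.swap (t - i) (t - i + 1)).prod =
      insert t (Finset.Icc 1 a) := by
  ext y
  simp only [Finset.mem_image, Finset.mem_Icc, Finset.mem_insert,
    prod_swap_descending_apply t h _ hht.le]
  constructor
  · rintro ⟨x, hx, rfl⟩
    split_ifs <;> omega
  · intro hy
    by_cases hyt : y = t
    · exact ⟨t - h, by omega, by simp [hyt]⟩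
    · by_cases hyh : y < t - h
      · exact ⟨y, by omega, by split_ifs <;> omega⟩
      · exact ⟨y + 1, by omega, by split_ifs <;> omega⟩

/-- Multiplying `w` on the right by a column word of height between `r` and `k` adds one element
to the image of the initial segment that it tracks. -/
theorem image_mul_column (k r m h : ℕ) (w : Equiv.Perm ℕ) (hrk : r ≤ k) (hrh : r ≤ h)
    (hhk : h ≤ k) (hr : 1 ≤ r) (hfix : ∀ x, k + m < x → w x = x)
    (himage : (Finset.Icc 1 (k - r + m)).image ⇑w =
      Finset.Icc 1 (k - r) ∪ Finset.Icc (k + 1) (k + m)) :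
    (Finset.Icc 1 (k - r + m + 1)).image
        ⇑(w * ((List.range' 1 h).map fun i =>
          Equiv.swap (k + (m + 1) - i) (k + (m + 1) - i + 1)).prod) =
      Finset.Icc 1 (k - r) ∪ Finset.Icc (k + 1) (k + (m + 1)) := by
  rw [Equiv.Perm.coe_mul, ← Finset.image_image,
    image_prod_swap_descending _ _ _ (by omega) (by omega) (by omega),
    Finset.image_insert, himage, hfix _ (by omega)]
  ext y
  simp only [Finset.mem_insert, Finset.mem_union, Finset.mem_Icc]
  omega

theorem image_prod_columns (k r m : ℕ) (f : ℕ → ℕ) (hr : 1 ≤ r) (hrk : r ≤ k)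
    (hrf : ∀ j, 1 ≤ j → j ≤ m → r ≤ f j) (hfk : ∀ j, f j ≤ k) :
    (∀ x, k + m < x →
      ((List.range' 1 m).flatMap fun j => (List.range' 1 (f j)).map fun i =>
        Equiv.swap (k + j - i) (k + j - i + 1)).prod x = x) ∧
    (Finset.Icc 1 (k - r + m)).image
        ⇑((List.range' 1 m).flatMap fun j => (List.range' 1 (f j)).map fun i =>
          Equiv.swap (k + j - i) (k + j - i + 1)).prod =
      Finset.Icc 1 (k - r) ∪ Finset.Icc (k + 1) (k + m) := by
  induction m with
  | zero => simp
  | succ m ih =>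
    obtain ⟨hfix, himage⟩ := ih fun j h1 h2 => hrf j h1 (by omega)
    have hcol := hfk (m + 1)
    rw [List.range'_concat, List.flatMap_append, List.prod_append, List.flatMap_singleton,
      show 1 + 1 * m = m + 1 by omega]
    refine ⟨fun x hx => ?_, image_mul_column k r m _ _ hrk (hrf _ (by omega) le_rfl) hcol hr
      hfix himage⟩
    rw [Equiv.Perm.mul_apply, prod_swap_descending_apply _ _ _ (by omega), if_neg (by omega),
      if_neg (by omega), hfix x (by omega)]

theorem colHeight_le (k : ℕ) (lam : ℕ → ℕ) (j : ℕ) : colHeight k lam j ≤ k :=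
  (Finset.card_filter_le _ _).trans (by simp)

theorem isYoung.antitone {n k : ℕ} {lam : ℕ → ℕ} (hlam : isYoung n k lam) {i r : ℕ}
    (hi : 1 ≤ i) (hir : i ≤ r) (hrk : r ≤ k) : lam r ≤ lam i := by
  induction r, hir using Nat.le_induction with
  | base => exact le_rfl
  | succ r hir ih => exact (hlam.2 r (by omega) (by omega)).trans (ih (by omega))

theorem isYoung.le_colHeight {n k : ℕ} {lam : ℕ → ℕ} (hlam : isYoung n k lam) {r j : ℕ}
    (hrk : r ≤ k) (hj : j ≤ lam r) : r ≤ colHeight k lam j := by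
  have hsub : Finset.Icc 1 r ⊆ (Finset.Icc 1 k).filter fun i => j ≤ lam i := by
    intro i hi
    rw [Finset.mem_Icc] at hi
    rw [Finset.mem_filter, Finset.mem_Icc]
    exact ⟨⟨hi.1, hi.2.trans hrk⟩, hj.trans (hlam.antitone hi.1 hi.2 hrk)⟩
  simpa [colHeight] using Finset.card_le_card hsub

theorem image_colWord {n k r c : ℕ} {lam : ℕ → ℕ} (hlam : isYoung n k lam) (hr : 1 ≤ r)
    (hrk : r ≤ k) (hc1 : 1 ≤ c) (hc : c ≤ lam r) :
    (Finset.Icc 1 (k + c - r)).image ⇑(colWord k lam r c) =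
      Finset.Icc 1 (k - r) ∪ Finset.Icc (k + 1) (k + c) := by
  obtain ⟨m, rfl⟩ : ∃ m, c = m + 1 := ⟨c - 1, by omega⟩
  obtain ⟨hfix, himage⟩ := image_prod_columns k r m (colHeight k lam) hr hrk
    (fun j _ hj => hlam.le_colHeight hrk (by omega)) (colHeight_le k lam)
  rw [colWord, List.prod_append, Nat.add_sub_cancel,
    show k + (m + 1) - r = k - r + m + 1 by omega]
  exact image_mul_column k r m r _ hrk le_rfl hrk hr hfix himage

/-- for a cell `b = (r,c)` of `λ` with `ℓ = k+c−r` and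
`J(b) = {1,…,k−r} ∪ {k−r+c+1,…,k+c}`, the partial columnar word `w_b` satisfies:
if `ℓ < k` then `J(b) = w_b({1,…,ℓ}) ∪ {ℓ+1,…,k}`; if `ℓ = k` then `J(b) = w_b({1,…,k})`;
and if `ℓ > k` then `J(b) = w_b({1,…,ℓ}) ∖ {k+1,…,ℓ}`. -/
theorem partial_columnar_word_image (n k r c : ℕ)
    (hn : 2 ≤ n) (hk1 : 1 < k) (hkn : k < n)
    (lam : ℕ → ℕ) (hlam : isYoung n k lam)
    (hr1 : 1 ≤ r) (hrk : r ≤ k) (hc1 : 1 ≤ c) (hc : c ≤ lam r) :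
    (k + c - r < k →
      Finset.Icc 1 (k - r) ∪ Finset.Icc (k - r + c + 1) (k + c) =
        (Finset.Icc 1 (k + c - r)).image ⇑(colWord k lam r c) ∪
          Finset.Icc (k + c - r + 1) k) ∧
    (k + c - r = k →
      Finset.Icc 1 (k - r) ∪ Finset.Icc (k - r + c + 1) (k + c) =
        (Finset.Icc 1 k).image ⇑(colWord k lam r c)) ∧
    (k < k + c - r →
      Finset.Icc 1 (k - r) ∪ Finset.Icc (k - r + c + 1) (k + c) =
        (Finset.Icc 1 (k + c - r)).image ⇑(colWord k lam r c) \
          Finset.Icc (k + 1) (k + c - r)) := by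
  rw [image_colWord hlam hr1 hrk hc1 hc]
  refine ⟨fun hl => ?_, fun hl => ?_, fun hl => ?_⟩
  · ext y
    simp only [Finset.mem_union, Finset.mem_Icc]
    omega
  · have himage := image_colWord hlam hr1 hrk hc1 hc
    rw [hl] at himage
    rw [himage, show k - r + c = k by omega]
  · ext y
    simp only [Finset.mem_union, Finset.mem_sdiff, Finset.mem_Icc]
    omega
end

section
/- Let r and c be integers with 1 ≤ r ≤ k and 1 ≤ c ≤ n−k, and let i_1 < i_2 < ⋯ < i_c be integers with i_1 ≥ 1 and i_c = k+c−r. Define w := (s_k s_{k−1} ⋯ s_{i_1})(s_{k+1} s_k ⋯ s_{i_2}) ⋯ (s_{k+c−1} s_{k+c−2} ⋯ s_{i_c}) ∈ S_n, where the t-th parenthesized factor is the descending product s_{k+t−1} s_{k+t−2} ⋯ s_{i_t} and the rightmost factor of the entire word is applied first. Then w({1,…,k+c−r}) = {1,…,k−r} ∪ {k+1,…,k+c}. -/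
/-- The descending product `s_{a+l-1} ⋯ s_a` sends `a` to `a + l` and shifts `a+1, …, a+l`
down by one. -/
theorem prod_descending_swaps_apply (a l x : ℕ) :
    (((List.range' a l).reverse).map fun b => Equiv.swap b (b + 1)).prod x
      = if x = a then a + l else if a < x ∧ x ≤ a + l then x - 1 else x := by
  induction l with
  | zero =>
    simp only [List.range'_zero, List.reverse_nil, List.map_nil, List.prod_nil,
      Equiv.Perm.coe_one, id_eq]
    split_ifs <;> omega
  | succ l ih =>
    rw [List.range'_concat, List.reverse_append, List.map_append, List.prod_append,
      Equiv.Perm.mul_apply, ih]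
    simp only [List.reverse_singleton, List.map_cons, List.map_nil, List.prod_singleton,
      Equiv.swap_apply_def, one_mul]
    split_ifs <;> omega

/-- A descending product `s_{a+l-1} ⋯ s_a` with `1 ≤ a ≤ m + 1 ≤ a + l` sends the interval
`{1, …, m+1}` to `{1, …, m} ∪ {a + l}`. -/
theorem image_Icc_prod_descending_swaps {a l m : ℕ} (ha : 1 ≤ a) (ham : a ≤ m + 1)
    (hml : m + 1 ≤ a + l) :
    (Finset.Icc 1 (m + 1)).image
      ⇑(((List.range' a l).reverse).map fun b => Equiv.swap b (b + 1)).prod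
      = insert (a + l) (Finset.Icc 1 m) := by
  ext y
  simp only [Finset.mem_image, Finset.mem_Icc, Finset.mem_insert, prod_descending_swaps_apply]
  constructor
  · rintro ⟨x, hx, rfl⟩
    split_ifs <;> omega
  · rintro (rfl | hy)
    · exact ⟨a, ⟨ha, ham⟩, by simp⟩
    · by_cases h : y < a
      · exact ⟨y, by omega, by split_ifs <;> omega⟩
      · exact ⟨y + 1, by omega, by split_ifs <;> omega⟩

/-- A product of `c` descending runs with tops `k, …, k+c-1` fixes every point above `k + c`. -/
theorem prod_descending_runs_apply_of_lt (k : ℕ) (i : ℕ → ℕ) (c : ℕ)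
    (hi : ∀ t, 1 ≤ t → t ≤ c → i t ≤ k + t) {x : ℕ} (hx : k + c < x) :
    ((List.range' 1 c).flatMap fun t =>
      ((List.range' (i t) (k + t - i t)).reverse).map fun a => Equiv.swap a (a + 1)).prod x
      = x := by
  induction c with
  | zero => simp
  | succ c ih =>
    have hc := hi (c + 1) (by omega) le_rfl
    rw [List.range'_concat, List.flatMap_append, List.prod_append, Equiv.Perm.mul_apply,
      List.flatMap_singleton, prod_descending_swaps_apply, one_mul, add_comm 1 c,
      if_neg (by omega), if_neg (by omega)]
    exact ih (fun t h1 h2 => hi t h1 (by omega)) (by omega)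

/-- The image of `{1, …, k+c-r}` under a product of `c` descending runs, assuming only
`1 ≤ i_t ≤ k + t - r`. -/
theorem image_Icc_prod_descending_runs {k r : ℕ} (hr : 1 ≤ r) (hrk : r ≤ k) (i : ℕ → ℕ) (c : ℕ)
    (hi1 : ∀ t, 1 ≤ t → t ≤ c → 1 ≤ i t) (hi : ∀ t, 1 ≤ t → t ≤ c → i t + r ≤ k + t) :
    (Finset.Icc 1 (k + c - r)).image
      ⇑(((List.range' 1 c).flatMap fun t =>
          ((List.range' (i t) (k + t - i t)).reverse).map fun a =>
            Equiv.swap a (a + 1)).prod)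
      = Finset.Icc 1 (k - r) ∪ Finset.Icc (k + 1) (k + c) := by
  induction c with
  | zero => simp
  | succ c ih =>
    have hc1 := hi1 (c + 1) (by omega) le_rfl
    have hc := hi (c + 1) (by omega) le_rfl
    have hm : k + (c + 1) - r = k + c - r + 1 := by omega
    have hl : i (c + 1) + (k + (c + 1) - i (c + 1)) = k + c + 1 := by omega
    rw [List.range'_concat, List.flatMap_append, List.prod_append, Equiv.Perm.coe_mul,
      ← Finset.image_image, List.flatMap_singleton, one_mul, add_comm 1 c, hm,
      image_Icc_prod_descending_swaps hc1 (by omega) (by omega), hl, Finset.image_insert,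
      prod_descending_runs_apply_of_lt k i c
        (fun t h1 h2 => by have := hi t h1 (by omega); omega) (by omega),
      ih (fun t h1 h2 => hi1 t h1 (by omega)) (fun t h1 h2 => hi t h1 (by omega))]
    ext y
    simp only [Finset.mem_insert, Finset.mem_union, Finset.mem_Icc]
    omega

/-- for `1 ≤ r ≤ k`, `1 ≤ c ≤ n−k` and `1 ≤ i_1 < i_2 < ⋯ < i_c = k+c−r`,
the permutation `w = (s_k ⋯ s_{i_1})(s_{k+1} ⋯ s_{i_2}) ⋯ (s_{k+c−1} ⋯ s_{i_c})`
(each parenthesized factor a descending run, the rightmost factor applied first)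
satisfies `w({1,…,k+c−r}) = {1,…,k−r} ∪ {k+1,…,k+c}`. -/
theorem descending_runs_image (n k r c : ℕ)
    (hn : 2 ≤ n) (hk1 : 1 < k) (hkn : k < n)
    (hr1 : 1 ≤ r) (hrk : r ≤ k) (hc1 : 1 ≤ c) (hcn : c ≤ n - k)
    (i : ℕ → ℕ) (hi1 : 1 ≤ i 1)
    (himono : ∀ t, 1 ≤ t → t < c → i t < i (t + 1))
    (hic : i c = k + c - r) :
    (Finset.Icc 1 (k + c - r)).image
      ⇑(((List.range' 1 c).flatMap fun t =>
          ((List.range' (i t) (k + t - i t)).reverse).map fun a =>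
            Equiv.swap a (a + 1)).prod)
      = Finset.Icc 1 (k - r) ∪ Finset.Icc (k + 1) (k + c) := by
  have hpos : ∀ t, 1 ≤ t → t ≤ c → 1 ≤ i t := by
    intro t ht
    induction t, ht using Nat.le_induction with
    | base => exact fun _ => hi1
    | succ t ht ih =>
      intro htc
      have := ih (by omega)
      have := himono t ht (by omega)
      omega
  have hle : ∀ d t, 1 ≤ t → t + d = c → i t + r ≤ k + t := by
    intro d
    induction d with
    | zero =>
      rintro t - rfl
      rw [add_zero] at hic
      omega
    | succ d ih =>
      intro t ht htd
      have := ih (t + 1) (by omega) (by omega)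
      have := himono t ht (by omega)
      omega
  exact image_Icc_prod_descending_runs hr1 hrk i c hpos
    fun t h1 h2 => hle (c - t) t h1 (by omega)
end

section
/- Let y ∈ W^K_min, let λ be the Young diagram contained in the k×(n−k) rectangle with vert(λ) = y^{-1}({1,…,k}), let (J_1,…,J_n) be the Grassmann necklace of y, and let {1,…,p} ∪ {q,…,n} (with 0 ≤ p ≤ k < q ≤ n+1) be the set of fixed points of y. Then J_i = {1,…,k} for every i with i ≤ p+1 or i ≥ q, and for every i with p+1 < i < q there exists a λ-frozen pair (r,c) such that J_i = Rec(r,c). -/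
/-- `vert(λ) = {λ_{k+1−i} + i : 1 ≤ i ≤ k}`. -/
def vert (k : ℕ) (lam : ℕ → ℕ) : Finset ℕ :=
  (Finset.Icc 1 k).image fun i => lam (k + 1 - i) + i

/-- auxiliary recursion for the Grassmann necklace: `necklaceAux n k y m = J_{m+1}`. -/
def necklaceAux (n k : ℕ) (y : Equiv.Perm ℕ) : ℕ → Finset ℕ
  | 0 => (Finset.Icc 1 n).filter fun i => i < y.symm i ∨ (i ≤ k ∧ y i = i)
  | m + 1 =>
      if m + 1 ∈ necklaceAux n k y m then
        insert (y (m + 1)) ((necklaceAux n k y m).erase (m + 1))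
      else necklaceAux n k y m

/-- the Grassmann necklace `J_1, …, J_n` of `y` (1-indexed). -/
def necklace (n k : ℕ) (y : Equiv.Perm ℕ) (i : ℕ) : Finset ℕ :=
  necklaceAux n k y (i - 1)

/-- `Rec(r,c) = {1,…,k−r} ∪ {k−r+c+1,…,k+c}`, the vertical steps of the `r × c` rectangle. -/
def recSet (k r c : ℕ) : Finset ℕ :=
  Finset.Icc 1 (k - r) ∪ Finset.Icc (k - r + c + 1) (k + c)

theorem symm_mem_Icc {n : ℕ} {y : Equiv.Perm ℕ} (hy : fixesOutside n y) {j : ℕ}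
    (h1 : 1 ≤ j) (hn : j ≤ n) : 1 ≤ y.symm j ∧ y.symm j ≤ n := by
  by_contra h
  have h' : y.symm j ∉ Finset.Icc 1 n := by simpa [Finset.mem_Icc] using h
  have e := hy _ h'
  rw [Equiv.apply_symm_apply] at e
  exact h (by omega)

theorem apply_mem_Icc {n : ℕ} {y : Equiv.Perm ℕ} (hy : fixesOutside n y) {i : ℕ}
    (h1 : 1 ≤ i) (hn : i ≤ n) : 1 ≤ y i ∧ y i ≤ n := by
  by_contra h
  have h' : y i ∉ Finset.Icc 1 n := by simpa [Finset.mem_Icc] using h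
  have e := y.injective (hy _ h')
  exact h (by omega)

theorem le_symm_of_isWKmin {n k : ℕ} {y : Equiv.Perm ℕ} (hkn : k < n) (hy : isWKmin n k y)
    (i : ℕ) (h1 : 1 ≤ i) (hik : i ≤ k) : i ≤ y.symm i := by
  induction i, h1 using Nat.le_induction with
  | base => exact (symm_mem_Icc hy.1 le_rfl (by omega)).1
  | succ i h1 ih =>
    have := hy.2.1 i (i + 1) h1 (by omega) hik
    have := ih (by omega)
    omega

theorem symm_le_of_isWKmin {n k : ℕ} {y : Equiv.Perm ℕ} (hy : isWKmin n k y)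
    (i : ℕ) (hki : k + 1 ≤ i) (hin : i ≤ n) : y.symm i ≤ i := by
  obtain ⟨d, rfl⟩ := Nat.exists_eq_add_of_le hin
  induction d generalizing i with
  | zero => exact (symm_mem_Icc hy.1 (by omega) le_rfl).2
  | succ d ih =>
    rw [show i + (d + 1) = i + 1 + d by omega] at hy
    have := hy.2.2 i (i + 1) hki (by omega) (by omega)
    have := ih (i + 1) (by omega) hy (by omega)
    omega

theorem necklaceAux_zero_eq {n k : ℕ} {y : Equiv.Perm ℕ} (hkn : k < n) (hy : isWKmin n k y) :
    necklaceAux n k y 0 = Finset.Icc 1 k := by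
  ext i
  simp only [necklaceAux, Finset.mem_filter, Finset.mem_Icc]
  constructor
  · rintro ⟨⟨h1, hin⟩, h⟩
    refine ⟨h1, ?_⟩
    by_contra hk
    have := symm_le_of_isWKmin hy i (by omega) hin
    omega
  · rintro ⟨h1, hik⟩
    refine ⟨⟨h1, by omega⟩, ?_⟩
    rcases (le_symm_of_isWKmin hkn hy i h1 hik).lt_or_eq with h | h
    · exact Or.inl h
    · exact Or.inr ⟨hik, y.symm_apply_eq.mp h.symm |>.symm⟩

/-- The first `a + b` values of `y` are `1, …, a` and `k + 1, …, k + b`. -/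
structure PrefixCounts (n k : ℕ) (y : Equiv.Perm ℕ) (a b : ℕ) : Prop where
  left_le : a ≤ k
  right_le : k + b ≤ n
  symm_le_iff_left : ∀ j, 1 ≤ j → j ≤ k → (y.symm j ≤ a + b ↔ j ≤ a)
  symm_le_iff_right : ∀ j, k + 1 ≤ j → j ≤ n → (y.symm j ≤ a + b ↔ j ≤ k + b)

theorem PrefixCounts.apply_eq_left {n k : ℕ} {y : Equiv.Perm ℕ} {a b : ℕ}
    (h : PrefixCounts n k y a b) (hy : isWKmin n k y) (hn : a + b + 1 ≤ n)
    (hk : y (a + b + 1) ≤ k) : y (a + b + 1) = a + 1 := by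
  have hj := (apply_mem_Icc hy.1 (by omega) hn).1
  have hv : y.symm (y (a + b + 1)) = a + b + 1 := y.symm_apply_apply _
  have h1 := h.symm_le_iff_left _ hj hk
  by_contra hne
  have h2 := hy.2.1 (a + 1) _ (by omega) (by omega : a + 1 < y (a + b + 1)) hk
  have h3 := h.symm_le_iff_left (a + 1) (by omega) (by omega)
  omega

theorem PrefixCounts.apply_eq_right {n k : ℕ} {y : Equiv.Perm ℕ} {a b : ℕ}
    (h : PrefixCounts n k y a b) (hy : isWKmin n k y) (hn : a + b + 1 ≤ n)
    (hk : k < y (a + b + 1)) : y (a + b + 1) = k + b + 1 := by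
  have hj := (apply_mem_Icc hy.1 (by omega) hn).2
  have hv : y.symm (y (a + b + 1)) = a + b + 1 := y.symm_apply_apply _
  have h1 := h.symm_le_iff_right _ hk hj
  by_contra hne
  have h2 := hy.2.2 (k + b + 1) _ (by omega) (by omega : k + b + 1 < y (a + b + 1)) hj
  have h3 := h.symm_le_iff_right (k + b + 1) (by omega) (by omega)
  omega

theorem PrefixCounts.succ_left {n k : ℕ} {y : Equiv.Perm ℕ} {a b : ℕ}
    (h : PrefixCounts n k y a b) (hk : a + 1 ≤ k)
    (hv : y (a + b + 1) = a + 1) : PrefixCounts n k y (a + 1) b := by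
  have key : ∀ j, y.symm j = a + b + 1 ↔ j = a + 1 := fun j => by
    rw [Equiv.symm_apply_eq, hv]
  refine ⟨hk, h.right_le, fun j h1 hj => ?_, fun j h1 hj => ?_⟩
  · have := h.symm_le_iff_left j h1 hj
    have := key j
    omega
  · have := h.symm_le_iff_right j h1 hj
    have := key j
    omega

theorem PrefixCounts.succ_right {n k : ℕ} {y : Equiv.Perm ℕ} {a b : ℕ}
    (h : PrefixCounts n k y a b) (hk : k + b + 1 ≤ n)
    (hv : y (a + b + 1) = k + b + 1) : PrefixCounts n k y a (b + 1) := by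
  have key : ∀ j, y.symm j = a + b + 1 ↔ j = k + b + 1 := fun j => by
    rw [Equiv.symm_apply_eq, hv]
  refine ⟨h.left_le, hk, fun j h1 hj => ?_, fun j h1 hj => ?_⟩
  · have := h.symm_le_iff_left j h1 hj
    have := key j
    omega
  · have := h.symm_le_iff_right j h1 hj
    have := key j
    omega

theorem mem_recSet_sub {k a b x : ℕ} (ha : a ≤ k) :
    x ∈ recSet k (k - a) b ↔ (1 ≤ x ∧ x ≤ a) ∨ (a + b + 1 ≤ x ∧ x ≤ k + b) := by
  simp only [recSet, Finset.mem_union, Finset.mem_Icc]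
  omega

theorem recSet_eq_Icc {k a b : ℕ} (ha : a ≤ k) (h : b = 0 ∨ a = k) :
    recSet k (k - a) b = Finset.Icc 1 k := by
  ext x
  rw [mem_recSet_sub ha, Finset.mem_Icc]
  omega

theorem exists_prefixCounts {n k : ℕ} {y : Equiv.Perm ℕ} (hkn : k < n) (hy : isWKmin n k y)
    (m : ℕ) (hm : m ≤ n) :
    ∃ a b, a + b = m ∧ PrefixCounts n k y a b ∧
      necklaceAux n k y m = recSet k (k - a) b := by
  induction m with
  | zero =>
    refine ⟨0, 0, rfl, ⟨by omega, by omega, fun j h1 hj => ?_, fun j h1 hj => ?_⟩, ?_⟩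
    · have := (symm_mem_Icc hy.1 h1 (by omega)).1
      omega
    · have := (symm_mem_Icc hy.1 (by omega) hj).1
      omega
    · rw [necklaceAux_zero_eq hkn hy, recSet_eq_Icc (by omega) (Or.inl rfl)]
  | succ m ih =>
    obtain ⟨a, b, rfl, h, hJ⟩ := ih (by omega)
    have ha := h.left_le
    rcases le_or_gt (y (a + b + 1)) k with hk | hk
    · have hv := h.apply_eq_left hy hm hk
      refine ⟨a + 1, b, by omega, h.succ_left (by omega) hv, ?_⟩
      rw [necklaceAux, hJ, if_pos ((mem_recSet_sub ha).2 (by omega)), hv]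
      ext x
      rw [mem_recSet_sub (by omega), Finset.mem_insert, Finset.mem_erase, mem_recSet_sub ha]
      omega
    · have hv := h.apply_eq_right hy hm hk
      have hn := (apply_mem_Icc hy.1 (by omega) hm).2
      refine ⟨a, b + 1, by omega, h.succ_right (by omega) hv, ?_⟩
      rw [necklaceAux, hJ, hv]
      ext x
      split_ifs with hmem
      · rw [mem_recSet_sub ha] at hmem
        rw [mem_recSet_sub ha, Finset.mem_insert, Finset.mem_erase, mem_recSet_sub ha]
        omega
      · rw [mem_recSet_sub ha] at hmem
        rw [mem_recSet_sub ha, mem_recSet_sub ha]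
        omega

/-- A strictly increasing enumeration of a finite set of naturals is determined by the set. -/
theorem eqOn_of_image_Icc_eq {k : ℕ} {f g : ℕ → ℕ}
    (hf : ∀ i j, 1 ≤ i → i < j → j ≤ k → f i < f j)
    (hg : ∀ i j, 1 ≤ i → i < j → j ≤ k → g i < g j)
    (h : (Finset.Icc 1 k).image f = (Finset.Icc 1 k).image g)
    (i : ℕ) (h1 : 1 ≤ i) (hik : i ≤ k) : f i = g i := by
  induction i using Nat.strong_induction_on with
  | _ i ih =>
    have hfi : f i ∈ (Finset.Icc 1 k).image g :=
      h ▸ Finset.mem_image_of_mem f (Finset.mem_Icc.2 ⟨h1, hik⟩)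
    have hgi : g i ∈ (Finset.Icc 1 k).image f :=
      h ▸ Finset.mem_image_of_mem g (Finset.mem_Icc.2 ⟨h1, hik⟩)
    simp only [Finset.mem_image, Finset.mem_Icc] at hfi hgi
    obtain ⟨j, ⟨hj1, hjk⟩, hj⟩ := hfi
    obtain ⟨l, ⟨hl1, hlk⟩, hl⟩ := hgi
    apply le_antisymm
    · rcases lt_trichotomy l i with hli | rfl | hli
      · have := ih l hli hl1 hlk
        have := hg l i hl1 hli hik
        omega
      · exact hl.le
      · have := hf i l h1 hli hlk
        omega
    · rcases lt_trichotomy j i with hji | rfl | hji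
      · have := ih j hji hj1 hjk
        have := hf j i hj1 hji hik
        omega
      · exact hj.le
      · have := hg i j h1 hji hjk
        omega

theorem isYoung.antitone_s10 {n k : ℕ} {lam : ℕ → ℕ} (h : isYoung n k lam) {r s : ℕ}
    (h1 : 1 ≤ r) (hrs : r ≤ s) (hs : s ≤ k) : lam s ≤ lam r := by
  induction s, hrs using Nat.le_induction with
  | base => exact le_rfl
  | succ s hrs ih => exact (h.2 s (by omega) (by omega)).trans (ih (by omega))

theorem add_eq_symm_of_vert_eq {n k : ℕ} {y : Equiv.Perm ℕ} {lam : ℕ → ℕ}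
    (hy : isWKmin n k y) (hlam : isYoung n k lam)
    (hvert : vert k lam = (Finset.Icc 1 k).image ⇑y.symm) (i : ℕ) (h1 : 1 ≤ i) (hik : i ≤ k) :
    lam (k + 1 - i) + i = y.symm i := by
  refine eqOn_of_image_Icc_eq (f := fun i => lam (k + 1 - i) + i) (fun i j h1 hij hj => ?_)
    hy.2.1 hvert i h1 hik
  have := hlam.antitone_s10 (r := k + 1 - j) (s := k + 1 - i) (by omega) (by omega) (by omega)
  omega

/-- for `y ∈ W^K_min` with fixed point set `{1,…,p} ∪ {q,…,n}`
and `λ` with `vert(λ) = y⁻¹({1,…,k})`, the Grassmann necklace satisfies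
`J_i = {1,…,k}` for `i ≤ p+1` or `i ≥ q`, and for `p+1 < i < q` the set `J_i` is
`Rec(r,c)` for some `λ`-frozen pair `(r,c)`. -/
theorem necklace_entries_are_frozen_rectangles (n k : ℕ)
    (hn : 2 ≤ n) (hk1 : 1 < k) (hkn : k < n)
    (y : Equiv.Perm ℕ) (hy : isWKmin n k y)
    (lam : ℕ → ℕ) (hlam : isYoung n k lam)
    (hvert : vert k lam = (Finset.Icc 1 k).image ⇑y.symm)
    (p q : ℕ) (hpk : p ≤ k) (hkq : k < q) (hqn : q ≤ n + 1)
    (hfix : ∀ i, 1 ≤ i → i ≤ n → (y i = i ↔ (i ≤ p ∨ q ≤ i))) :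
    (∀ i, 1 ≤ i → i ≤ n → (i ≤ p + 1 ∨ q ≤ i) →
        necklace n k y i = Finset.Icc 1 k) ∧
    (∀ i, p + 1 < i → i < q →
        ∃ r c, (1 ≤ r ∧ r ≤ k ∧ 1 ≤ c ∧ c ≤ lam r ∧
            ¬(r + 1 ≤ k ∧ c + 1 ≤ lam (r + 1))) ∧
          necklace n k y i = recSet k r c) := by
  have hfixed : ∀ i, 1 ≤ i → i ≤ n → (y.symm i = i ↔ (i ≤ p ∨ q ≤ i)) := fun i h1 hi => by
    rw [← hfix i h1 hi, Equiv.symm_apply_eq, eq_comm]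
  refine ⟨fun i h1 hin hi => ?_, fun i hpi hiq => ?_⟩
  · obtain ⟨a, b, hab, h, hJ⟩ := exists_prefixCounts hkn hy (i - 1) (by omega)
    have ha := h.left_le
    have hb := h.right_le
    rw [necklace, hJ]
    refine recSet_eq_Icc ha ?_
    rcases hi with hi | hi
    · left
      by_contra hb0
      have h2 := h.symm_le_iff_right (k + 1) le_rfl (by omega)
      have h3 := (hfix (y.symm (k + 1)) (symm_mem_Icc hy.1 (by omega) (by omega)).1
        (symm_mem_Icc hy.1 (by omega) (by omega)).2).2 (by omega)
      rw [Equiv.apply_symm_apply] at h3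
      omega
    · right
      by_contra hak
      have h2 := h.symm_le_iff_left k (by omega) le_rfl
      have h3 := (hfix (y.symm k) (symm_mem_Icc hy.1 (by omega) (by omega)).1
        (symm_mem_Icc hy.1 (by omega) (by omega)).2).2 (by omega)
      rw [Equiv.apply_symm_apply] at h3
      omega
  · obtain ⟨a, b, hab, h, hJ⟩ := exists_prefixCounts hkn hy (i - 1) (by omega)
    have ha := h.left_le
    have hb := h.right_le
    have hlamv := add_eq_symm_of_vert_eq hy hlam hvert
    have hb0 : b ≠ 0 := by
      rintro rfl
      have h1 := apply_mem_Icc hy.1 (by omega : 1 ≤ p + 1) (by omega)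
      have hv : y.symm (y (p + 1)) = p + 1 := y.symm_apply_apply _
      have h2 := hfix (p + 1) (by omega) (by omega)
      have h3 := hfixed (y (p + 1)) h1.1 h1.2
      rcases le_or_gt (y (p + 1)) k with hk | hk
      · have := le_symm_of_isWKmin hkn hy _ h1.1 hk
        omega
      · have := h.symm_le_iff_right _ hk h1.2
        omega
    have hak : a ≠ k := by
      rintro rfl
      have hi : i = a + b + 1 := by omega
      have h3 := hfix i (by omega) (by omega)
      have h4 := (apply_mem_Icc hy.1 (by omega : 1 ≤ i) (by omega)).1
      have h5 : a < y i := by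
        by_contra hle
        have h6 := h.symm_le_iff_left (y i) h4 (by omega)
        rw [Equiv.symm_apply_apply] at h6
        omega
      rw [hi] at h5
      have := h.apply_eq_right hy (by omega) h5
      rw [← hi] at this
      omega
    refine ⟨k - a, b, ⟨by omega, by omega, by omega, ?_, ?_⟩, by rw [necklace, hJ]⟩
    · have h1 := hlamv (a + 1) (by omega) (by omega)
      have h2 := h.symm_le_iff_left (a + 1) (by omega) (by omega)
      rw [show k + 1 - (a + 1) = k - a by omega] at h1
      omega
    · rintro ⟨h1, h2⟩
      have h3 := hlamv a (by omega) (by omega)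
      have h4 := h.symm_le_iff_left a (by omega) (by omega)
      rw [show k + 1 - a = k - a + 1 by omega] at h3
      omega
end

section
/- Let R ⊆ [n] and let a, b, c, d be four distinct elements of [n], none of which belongs to R. Suppose that R∪{a,d} and R∪{b,c} are weakly separated, and that R∪{a,b} and R∪{c,d} are weakly separated. Then either (a,b,c,d) or (a,d,c,b) is cyclically ordered; equivalently, exactly one of b and d lies strictly between a and c in the usual linear order on [n]. -/
/-- `I` and `J` are weakly separated subsets of `ℕ`: there are no `a, b ∈ I ∖ J` and
`c, d ∈ J ∖ I` with `a < c < b < d` or `c < a < d < b`. -/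
def weaklySeparated (I J : Finset ℕ) : Prop :=
  ¬ ∃ a ∈ I \ J, ∃ b ∈ I \ J, ∃ c ∈ J \ I, ∃ d ∈ J \ I,
      (a < c ∧ c < b ∧ b < d) ∨ (c < a ∧ a < d ∧ d < b)

/-- If `R ∪ {p, q}` and `R ∪ {r, s}` are weakly separated, then the pairs `{p, q}` and `{r, s}`
do not cross: `r` lies strictly between `p` and `q` if and only if `s` does. -/
theorem weaklySeparated.between_iff {R : Finset ℕ} {p q r s : ℕ}
    (h : weaklySeparated (R ∪ {p, q}) (R ∪ {r, s}))
    (hp : p ∉ R) (hq : q ∉ R) (hr : r ∉ R) (hs : s ∉ R)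
    (hpr : p ≠ r) (hps : p ≠ s) (hqr : q ≠ r) (hqs : q ≠ s) :
    (min p q < r ∧ r < max p q) ↔ (min p q < s ∧ s < max p q) := by
  have mp : p ∈ (R ∪ {p, q}) \ (R ∪ {r, s}) := by simp [*]
  have mq : q ∈ (R ∪ {p, q}) \ (R ∪ {r, s}) := by simp [*]
  have mr : r ∈ (R ∪ {r, s}) \ (R ∪ {p, q}) := by simp [*, Ne.symm]
  have ms : s ∈ (R ∪ {r, s}) \ (R ∪ {p, q}) := by simp [*, Ne.symm]
  have key : ∀ x ∈ (R ∪ {p, q}) \ (R ∪ {r, s}), ∀ y ∈ (R ∪ {p, q}) \ (R ∪ {r, s}),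
      ∀ u ∈ (R ∪ {r, s}) \ (R ∪ {p, q}), ∀ v ∈ (R ∪ {r, s}) \ (R ∪ {p, q}),
      ¬ ((x < u ∧ u < y ∧ y < v) ∨ (u < x ∧ x < v ∧ v < y)) :=
    fun x hx y hy u hu v hv huv => h ⟨x, hx, y, hy, u, hu, v, hv, huv⟩
  have h₁ := key p mp q mq r mr s ms
  have h₂ := key p mp q mq s ms r mr
  have h₃ := key q mq p mp r mr s ms
  have h₄ := key q mq p mp s ms r mr
  omega

/-- if `R∪{a,d}` is weakly separated from `R∪{b,c}` and `R∪{a,b}` is weakly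
separated from `R∪{c,d}` (with `a,b,c,d` distinct and not in `R`), then exactly one of
`b` and `d` lies strictly between `a` and `c`; equivalently, `(a,b,c,d)` or `(a,d,c,b)`
is cyclically ordered. -/
theorem square_face_labels_cyclically_ordered (n : ℕ) (hn : 4 ≤ n)
    (R : Finset ℕ) (hR : R ⊆ Finset.Icc 1 n)
    (a b c d : ℕ)
    (ha : a ∈ Finset.Icc 1 n) (hb : b ∈ Finset.Icc 1 n)
    (hc : c ∈ Finset.Icc 1 n) (hd : d ∈ Finset.Icc 1 n)
    (haR : a ∉ R) (hbR : b ∉ R) (hcR : c ∉ R) (hdR : d ∉ R)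
    (hdist : [a, b, c, d].Nodup)
    (h1 : weaklySeparated (R ∪ {a, d}) (R ∪ {b, c}))
    (h2 : weaklySeparated (R ∪ {a, b}) (R ∪ {c, d})) :
    Xor' (min a c < b ∧ b < max a c) (min a c < d ∧ d < max a c) := by
  simp only [List.nodup_cons, List.mem_cons, List.not_mem_nil, or_false, not_or] at hdist
  obtain ⟨⟨hab, hac, had⟩, ⟨hbc, hbd⟩, hcd, -⟩ := hdist
  have h₁ := h1.between_iff haR hdR hbR hcR hab hac (Ne.symm hbd) (Ne.symm hcd)
  have h₂ := h2.between_iff haR hbR hcR hdR hac had hbc hbd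
  refine xor_def.mpr ?_
  omega
end
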